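/- In the polynomial ring ℚ[t,x], the polynomial h(t)·(1-(t+1)x)² - t⁶·h(x) lies in the ideal generated by t²x² - x - t + 1, where h(s) = s⁵ - s⁴ + s³ + s² - 2s + 1. Consequently, whenever elements t, u, x of a field of characteristic zero satisfy u² = h(t) and t²x² - x - t + 1 = 0, the element y = (u - (t+1)ux)/t³ (for t ≠ 0) satisfies y² = h(x). -/

import Mathlib

open MvPolynomial

/-- The quintic `h(s) = s⁵ - s⁴ + s³ + s² - 2s + 1` defining the genus two curve
`C : u² = h(t)` of discriminant 5. -/
def hRM5 {R : Type*} [CommRing R] (s : R) : R :=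
  s ^ 5 - s ^ 4 + s ^ 3 + s ^ 2 - 2 * s + 1

/-- The explicit cofactor identity. -/
theorem hRM5_cofactor {R : Type*} [CommRing R] (t x : R) :
    hRM5 t * (1 - (t + 1) * x) ^ 2 - t ^ 6 * hRM5 x =
      (t ^ 2 * x ^ 2 - x - t + 1) *
        (-t ^ 4 * x ^ 3 + t ^ 4 * x ^ 2 + t ^ 5 - t ^ 4 * x - t ^ 2 * x ^ 2 - t ^ 3 * x + t ^ 3
          + 2 * t ^ 2 * x - t - x + 1) := by
  unfold hRM5
  ring

/-- In ℚ[t,x] (with `t = X 0`, `x = X 1`), the polynomial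
`h(t)·(1-(t+1)x)² - t⁶·h(x)` lies in the ideal generated by `t²x² - x - t + 1`;
consequently, for `t, u, x` in a field of characteristic zero with `u² = h(t)`,
`t²x² - x - t + 1 = 0` and `t ≠ 0`, the element `y = (u - (t+1)ux)/t³`
satisfies `y² = h(x)`. -/
theorem second_projection_lands_on_curve_disc5 :
    (hRM5 (X 0) * (1 - (X 0 + 1) * X 1) ^ 2 - (X 0) ^ 6 * hRM5 (X 1)
        : MvPolynomial (Fin 2) ℚ) ∈
      Ideal.span {(X 0) ^ 2 * (X 1) ^ 2 - X 1 - X 0 + 1} ∧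
    ∀ (F : Type*) [Field F] [CharZero F] (t u x : F),
      u ^ 2 = hRM5 t → t ^ 2 * x ^ 2 - x - t + 1 = 0 → t ≠ 0 →
      ((u - (t + 1) * u * x) / t ^ 3) ^ 2 = hRM5 x := by
  refine ⟨Ideal.mem_span_singleton.mpr ⟨_, hRM5_cofactor _ _⟩, ?_⟩
  intro F _ _ t u x hu hF ht
  have h := hRM5_cofactor t x
  rw [hF, zero_mul] at h
  rw [div_pow, div_eq_iff (pow_ne_zero 2 (pow_ne_zero 3 ht))]
  linear_combination (1 - (t + 1) * x) ^ 2 * hu + h
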